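/- Let L be a finite type with an involution i ↦ i*, let δ : L → L → L → ℕ be invariant under all permutations of its three arguments, and let d : L → ℝ satisfy d(i*) = d(i) and the quantum-dimension identity d i · d j = Σ_k (δ i j k)·(d k). Set D² := Σ_i (d i)². Suppose F : L⁶ → ℂ satisfies the unitarity condition Σ_n |F(i*, j, m, k, ℓ*, n)|² = (δ i* j m*)·(δ k m ℓ*) for all i, j, m, k, ℓ. Then (D²)^{−4} · Σ_{i,j,k,ℓ,m,n} |F(i*, j, m, k, ℓ*, n)|² · (d i)·(d j)·(d k)·(d ℓ) = (D²)^{−1}. (This is the computation showing that the Turaev–Viro partition-function vector of the ball, triangulated by a single tetrahedron, has squared norm D^{−2}.) -/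

import Mathlib

open Finset

/-- Summing `d i * d j` against the fusion tensor with third label `m` fixed gives `D² * d m`. -/
theorem sum_sum_fusion_mul_dim {L : Type*} [Fintype L] (δ : L → L → L → ℕ) (d : L → ℝ)
    (hrot : ∀ i j k, δ i j k = δ i k j)
    (hdim : ∀ i j, d i * d j = ∑ k, (δ i j k : ℝ) * d k) (m : L) :
    ∑ i, ∑ j, (δ i j m : ℝ) * (d i * d j) = (∑ i, d i ^ 2) * d m := by
  rw [Finset.sum_mul]
  refine Finset.sum_congr rfl fun i _ => ?_
  rw [pow_two, mul_assoc, hdim i m, Finset.mul_sum]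
  refine Finset.sum_congr rfl fun j _ => ?_
  rw [hrot i j m]
  ring

/-- The Turaev–Viro partition-function vector of the ball, triangulated by a
single tetrahedron, has squared norm D^{−2}:
(D²)⁻⁴ · Σ_{i,j,k,ℓ,m,n} |F^{i*jm}_{kℓ*n}|² d_i d_j d_k d_ℓ = (D²)⁻¹. -/
theorem turaev_viro_ball_norm
    {L : Type*} [Fintype L] (star : L → L) (δ : L → L → L → ℕ) (d : L → ℝ)
    (F : L → L → L → L → L → L → ℂ)
    (hstar : ∀ i, star (star i) = i)
    (hswap : ∀ i j k, δ i j k = δ j i k)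
    (hrot : ∀ i j k, δ i j k = δ i k j)
    (hdstar : ∀ i, d (star i) = d i)
    (hdim : ∀ i j, d i * d j = ∑ k, (δ i j k : ℝ) * d k)
    (hunitary : ∀ i j m k ℓ,
      ∑ n, ‖F (star i) j m k (star ℓ) n‖ ^ 2 =
        (δ (star i) j (star m) : ℝ) * (δ k m (star ℓ) : ℝ)) :
    ((∑ i : L, d i ^ 2)⁻¹) ^ 4 *
      (∑ i : L, ∑ j : L, ∑ k : L, ∑ ℓ : L, ∑ m : L, ∑ n : L,
        ‖F (star i) j m k (star ℓ) n‖ ^ 2 * (d i * d j * d k * d ℓ)) =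
    (∑ i : L, d i ^ 2)⁻¹ := by
  have hinv : Function.Involutive star := hstar
  have hsum (f : L → ℝ) : ∑ i, f (star i) = ∑ i, f i :=
    Equiv.sum_comp hinv.toPerm f
  have hleft (m : L) :
      ∑ i, ∑ j, (δ (star i) j (star m) : ℝ) * (d i * d j) = (∑ i, d i ^ 2) * d m := by
    rw [← hdstar m, ← sum_sum_fusion_mul_dim δ d hrot hdim,
      ← hsum fun i => ∑ j, (δ i j (star m) : ℝ) * (d i * d j)]
    simp only [hdstar]
  have hright (m : L) :
      ∑ k, ∑ ℓ, (δ k m (star ℓ) : ℝ) * (d k * d ℓ) = (∑ i, d i ^ 2) * d m := by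
    rw [← sum_sum_fusion_mul_dim δ d hrot hdim]
    refine Finset.sum_congr rfl fun k _ => ?_
    rw [← hsum fun ℓ => (δ k ℓ m : ℝ) * (d k * d ℓ)]
    simp only [hdstar, hrot k m]
  have htotal : (∑ i : L, ∑ j : L, ∑ k : L, ∑ ℓ : L, ∑ m : L, ∑ n : L,
      ‖F (star i) j m k (star ℓ) n‖ ^ 2 * (d i * d j * d k * d ℓ)) = (∑ i, d i ^ 2) ^ 3 := by
    calc
      _ = ∑ i, ∑ j, ∑ k, ∑ ℓ, ∑ m, (δ (star i) j (star m) : ℝ) * (d i * d j) *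
            ((δ k m (star ℓ) : ℝ) * (d k * d ℓ)) := by
        simp only [← Finset.sum_mul, hunitary]
        simp only [Finset.sum_mul]
        iterate 5 refine Finset.sum_congr rfl fun _ _ => ?_
        ring
      _ = ∑ m, (∑ i, ∑ j, (δ (star i) j (star m) : ℝ) * (d i * d j)) *
            ∑ k, ∑ ℓ, (δ k m (star ℓ) : ℝ) * (d k * d ℓ) := by
        simp_rw [Finset.sum_mul]
        simp_rw [Finset.mul_sum]
        symm
        rw [Finset.sum_comm]
        refine Finset.sum_congr rfl fun i _ => ?_
        rw [Finset.sum_comm]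
        refine Finset.sum_congr rfl fun j _ => ?_
        rw [Finset.sum_comm]
        refine Finset.sum_congr rfl fun k _ => ?_
        exact Finset.sum_comm
      _ = ∑ m, (∑ i, d i ^ 2) ^ 2 * d m ^ 2 := by
        refine Finset.sum_congr rfl fun m _ => ?_
        rw [hleft, hright]
        ring
      _ = _ := by
        rw [← Finset.mul_sum]
        ring
  rw [htotal]
  rcases eq_or_ne (∑ i, d i ^ 2) 0 with h | h
  · simp [h]
  · field_simp
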